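/- Let A be a separable unital C*-algebra, let K, K' ⊆ A be two compact generating sets, and let a ∈ A. Then ω^{K'}_a(t) ≤ ω^K_a(ω^{K'}_K(t)) for all t ≥ 0, where ω^{K'}_K is the modulus associated to the compact set K regarded as a subset of A with respect to the metric d_{K'}. -/

import Mathlib

noncomputable section

abbrev H2 : Type := lp (fun _ : ℕ => ℂ) 2
abbrev BH : Type := H2 →L[ℂ] H2

abbrev RepSp (A : Type*) [CStarAlgebra A] := A →⋆ₐ[ℂ] BH

def Generates {A : Type*} [CStarAlgebra A] (K : Set A) : Prop :=
  (StarAlgebra.adjoin ℂ K).topologicalClosure = ⊤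

def dRep {A : Type*} [CStarAlgebra A] (K : Set A) (π₁ π₂ : RepSp A) : ℝ :=
  ⨆ a ∈ K, ‖π₁ a - π₂ a‖

/-- A modulus of continuity: a continuous, nondecreasing, concave function
`[0,∞) → [0,∞)` vanishing at `0`. -/
def IsModulus (ω : ℝ → ℝ) : Prop :=
  ContinuousOn ω (Set.Ici 0) ∧ MonotoneOn ω (Set.Ici 0) ∧
    ConcaveOn ℝ (Set.Ici 0) ω ∧ ω 0 = 0 ∧ ∀ t ∈ Set.Ici (0 : ℝ), 0 ≤ ω t

/-- `f^K_L(t) = sup {‖π(a) - π'(a)‖ : a ∈ L, d_K(π,π') ≤ t}`. -/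
def fMod {A : Type*} [CStarAlgebra A] (K L : Set A) (t : ℝ) : ℝ :=
  sSup {r : ℝ | ∃ a ∈ L, ∃ π π' : RepSp A, dRep K π π' ≤ t ∧ r = ‖π a - π' a‖}

/-- `ω^K_L(t) = inf {ω(t) : ω ∈ Ω, ω ≥ f^K_L on [0,∞)}`. -/
def omegaMod {A : Type*} [CStarAlgebra A] (K L : Set A) (t : ℝ) : ℝ :=
  sInf {y : ℝ | ∃ ω : ℝ → ℝ, IsModulus ω ∧
    (∀ s ∈ Set.Ici (0 : ℝ), fMod K L s ≤ ω s) ∧ y = ω t}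

/-- Given affine functions `ε + c ε * s`, one for each `ε > 0`, some modulus of continuity dominates
every common lower bound of them. -/
lemma exists_isModulus_of_affine_bounds (c : ℝ → ℝ) (hc : ∀ ε, 0 ≤ c ε) :
    ∃ ω : ℝ → ℝ, IsModulus ω ∧ ∀ s ∈ Set.Ici (0 : ℝ), ∀ y : ℝ,
      (∀ ε > 0, y ≤ ε + c ε * s) → y ≤ ω s := by
  let ω : ℝ → ℝ := fun t => ⨅ ε : Set.Ioi (0 : ℝ), ((ε : ℝ) + c ε * t)
  have : Nonempty (Set.Ioi (0 : ℝ)) := ⟨⟨1, Set.mem_Ioi.2 one_pos⟩⟩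
  have hnn : ∀ t, 0 ≤ t → ∀ ε : Set.Ioi (0 : ℝ), 0 ≤ (ε : ℝ) + c ε * t := fun t ht ε =>
    add_nonneg (le_of_lt ε.2) (mul_nonneg (hc _) ht)
  have hle : ∀ t, 0 ≤ t → ∀ ε > 0, ω t ≤ ε + c ε * t := fun t ht ε hε =>
    ciInf_le (f := fun ε : Set.Ioi (0 : ℝ) => (ε : ℝ) + c ε * t)
      ⟨0, by rintro _ ⟨ε, rfl⟩; exact hnn t ht ε⟩ ⟨ε, hε⟩
  have hge : ∀ t y : ℝ, (∀ ε > 0, y ≤ ε + c ε * t) → y ≤ ω t := fun t y h =>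
    le_ciInf fun ε => h ε ε.2
  have hpos : ∀ t, 0 ≤ t → 0 ≤ ω t := fun t ht => le_ciInf (hnn t ht)
  have hmono : ∀ s t, 0 ≤ s → s ≤ t → ω s ≤ ω t := fun s t hs hst =>
    hge t _ fun ε hε => (hle s hs ε hε).trans
      (by have := mul_le_mul_of_nonneg_left hst (hc ε); linarith)
  have hzero : ω 0 = 0 := by
    refine le_antisymm (le_of_forall_pos_le_add fun ε hε => ?_) (hpos 0 le_rfl)
    simpa using hle 0 le_rfl ε hε
  have hconc : ConcaveOn ℝ (Set.Ici 0) ω := by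
    refine ⟨convex_Ici 0, fun x hx y hy a b ha hb hab => hge _ _ fun ε hε => ?_⟩
    have h1 := mul_le_mul_of_nonneg_left (hle x hx ε hε) ha
    have h2 := mul_le_mul_of_nonneg_left (hle y hy ε hε) hb
    have h3 : a * (ε + c ε * x) + b * (ε + c ε * y) = ε + c ε * (a * x + b * y) := by
      linear_combination ε * hab
    simp only [smul_eq_mul]
    linarith
  have hscale : ∀ s r, 0 ≤ s → 0 ≤ r → 0 < s + r →
      s / (s + r) * ω (s + r) ≤ ω s := by
    intro s r hs hr h
    have := hconc.2 (Set.self_mem_Ici (a := (0 : ℝ))) (Set.mem_Ici.2 h.le)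
      (div_nonneg hr h.le) (div_nonneg hs h.le)
      (by rw [← add_div, add_comm r s, div_self h.ne'])
    simp only [smul_eq_mul, hzero, mul_zero, zero_add] at this
    rwa [div_mul_cancel₀ _ h.ne'] at this
  have hsub : ∀ s r, 0 ≤ s → 0 ≤ r → ω (s + r) ≤ ω s + ω r := by
    intro s r hs hr
    rcases (add_nonneg hs hr).eq_or_lt with h | h
    · rw [← h, hzero]
      exact add_nonneg (hpos s hs) (hpos r hr)
    · have h1 := hscale s r hs hr h
      have h2 := hscale r s hr hs (by linarith)
      rw [add_comm r s] at h2
      have h3 : s / (s + r) * ω (s + r) + r / (s + r) * ω (s + r) = ω (s + r) := by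
        field_simp
      linarith
  have hdist : ∀ s t, 0 ≤ s → 0 ≤ t → |ω s - ω t| ≤ ω |s - t| := by
    have key : ∀ s t, 0 ≤ s → s ≤ t → |ω s - ω t| ≤ ω |s - t| := by
      intro s t hs hst
      have h1 := hsub s (t - s) hs (by linarith)
      have h2 := hmono s t hs hst
      rw [add_sub_cancel] at h1
      rw [abs_sub_comm, abs_of_nonneg (by linarith), abs_sub_comm s t,
        abs_of_nonneg (by linarith)]
      linarith
    intro s t hs ht
    rcases le_total s t with h | h
    · exact key s t hs h
    · rw [abs_sub_comm, abs_sub_comm s t]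
      exact key t s ht h
  have hcont : ContinuousOn ω (Set.Ici 0) := by
    intro t ht
    rw [Metric.continuousWithinAt_iff]
    intro ε hε
    have hd : 0 < c (ε / 2) + 1 := by linarith [hc (ε / 2)]
    refine ⟨ε / 2 / (c (ε / 2) + 1), by positivity, fun {s} hs hst => ?_⟩
    rw [Real.dist_eq] at hst ⊢
    rw [lt_div_iff₀ hd] at hst
    have h1 := hdist s t hs ht
    have h2 := hle |s - t| (abs_nonneg _) (ε / 2) (by positivity)
    nlinarith [abs_nonneg (s - t)]
  exact ⟨ω, ⟨hcont, fun s hs t _ hst => hmono s t hs hst, hconc, hzero, hpos⟩,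
    fun s _ y => hge s y⟩

lemma IsModulus.comp {ω ω' : ℝ → ℝ} (h : IsModulus ω) (h' : IsModulus ω') :
    IsModulus fun t => ω (ω' t) := by
  obtain ⟨c, m, cv, z, p⟩ := h
  obtain ⟨c', m', cv', z', p'⟩ := h'
  refine ⟨c.comp c' p', fun s hs t ht hst => m (p' s hs) (p' t ht) (m' hs ht hst),
    ⟨convex_Ici 0, fun x hx y hy a b ha hb hab => ?_⟩, by simp [z, z'],
    fun t ht => p _ (p' t ht)⟩
  have hmem := cv.1 (p' x hx) (p' y hy) ha hb hab
  exact (cv.2 (p' x hx) (p' y hy) ha hb hab).trans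
    (m hmem (p' _ (cv'.1 hx hy ha hb hab)) (cv'.2 hx hy ha hb hab))

section Representations

variable {A : Type*} [CStarAlgebra A]

lemma RepSp.norm_sub_le (π π' : RepSp A) (a : A) : ‖π a - π' a‖ ≤ 2 * ‖a‖ := by
  have h := NonUnitalStarAlgHom.norm_apply_le π a
  have h' := NonUnitalStarAlgHom.norm_apply_le π' a
  linarith [_root_.norm_sub_le (π a) (π' a)]

lemma norm_sub_le_dRep {K : Set A} (hK : IsCompact K) (π π' : RepSp A) {a : A} (ha : a ∈ K) :
    ‖π a - π' a‖ ≤ dRep K π π' := by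
  obtain ⟨M, hM⟩ := hK.isBounded.exists_norm_le
  have hM0 : 0 ≤ M := (norm_nonneg a).trans (hM a ha)
  have hbdd : BddAbove (Set.range fun b : A => ⨆ _ : b ∈ K, ‖π b - π' b‖) := by
    refine ⟨2 * M, ?_⟩
    rintro _ ⟨b, rfl⟩
    refine Real.iSup_le (fun hb => (RepSp.norm_sub_le π π' b).trans ?_) (by positivity)
    linarith [hM b hb]
  simpa [ha, dRep] using le_ciSup hbdd a

lemma dRep_nonneg (K : Set A) (π π' : RepSp A) : 0 ≤ dRep K π π' :=
  Real.iSup_nonneg fun _ => Real.iSup_nonneg fun _ => norm_nonneg _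

lemma dRep_le {K : Set A} {π π' : RepSp A} {r : ℝ} (hr : 0 ≤ r)
    (h : ∀ a ∈ K, ‖π a - π' a‖ ≤ r) : dRep K π π' ≤ r :=
  Real.iSup_le (fun a => Real.iSup_le (h a) hr) hr

/-- Evaluation at a `*`-polynomial in elements of `K` is Lipschitz for `d_K`. -/
lemma exists_lipschitz_of_mem_adjoin {K : Set A} (hK : IsCompact K) {x : A}
    (hx : x ∈ StarAlgebra.adjoin ℂ K) :
    ∃ C : ℝ, 0 ≤ C ∧ ∀ π π' : RepSp A, ‖π x - π' x‖ ≤ C * dRep K π π' := by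
  induction hx using StarAlgebra.adjoin_induction with
  | mem x hx => exact ⟨1, zero_le_one, fun π π' => by simpa using norm_sub_le_dRep hK π π' hx⟩
  | algebraMap r => exact ⟨0, le_rfl, fun π π' => by simp [AlgHomClass.commutes]⟩
  | add x y _ _ hx hy =>
    obtain ⟨C, hC, h⟩ := hx
    obtain ⟨D, hD, h'⟩ := hy
    refine ⟨C + D, by positivity, fun π π' => ?_⟩
    rw [map_add, map_add, add_sub_add_comm, add_mul]
    exact norm_add_le_of_le (h π π') (h' π π')
  | mul x y _ _ hx hy =>
    obtain ⟨C, hC, h⟩ := hx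
    obtain ⟨D, hD, h'⟩ := hy
    refine ⟨‖x‖ * D + C * ‖y‖, by positivity, fun π π' => ?_⟩
    have heq : π (x * y) - π' (x * y) = π x * (π y - π' y) + (π x - π' x) * π' y := by
      rw [map_mul, map_mul]; noncomm_ring
    have hx' := NonUnitalStarAlgHom.norm_apply_le π x
    have hy' := NonUnitalStarAlgHom.norm_apply_le π' y
    have hd := dRep_nonneg K π π'
    calc ‖π (x * y) - π' (x * y)‖
        ≤ ‖π x‖ * ‖π y - π' y‖ + ‖π x - π' x‖ * ‖π' y‖ := by
          rw [heq]
          exact norm_add_le_of_le (norm_mul_le _ _) (norm_mul_le _ _)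
      _ ≤ ‖x‖ * (D * dRep K π π') + (C * dRep K π π') * ‖y‖ := by
          gcongr
          · exact h' π π'
          · exact h π π'
      _ = (‖x‖ * D + C * ‖y‖) * dRep K π π' := by ring
  | star x _ hx =>
    obtain ⟨C, hC, h⟩ := hx
    refine ⟨C, hC, fun π π' => ?_⟩
    rw [map_star, map_star, ← star_sub, norm_star]
    exact h π π'

/-- Evaluation on a compact set `L` is, up to any error `ε > 0`, uniformly Lipschitz for `d_K`. -/
lemma exists_affine_bound {K L : Set A} (hK : IsCompact K) (hgen : Generates K)
    (hL : IsCompact L) {ε : ℝ} (hε : 0 < ε) :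
    ∃ C : ℝ, 0 ≤ C ∧ ∀ a ∈ L, ∀ π π' : RepSp A, ‖π a - π' a‖ ≤ ε + C * dRep K π π' := by
  refine hL.induction_on ⟨0, le_rfl, by simp⟩ ?_ ?_ ?_
  · rintro s t hst ⟨C, hC, h⟩
    exact ⟨C, hC, fun a ha => h a (hst ha)⟩
  · rintro s t ⟨C, hC, h⟩ ⟨D, hD, h'⟩
    refine ⟨max C D, le_max_of_le_left hC, fun a ha π π' => ?_⟩
    have hd := dRep_nonneg K π π'
    rcases ha with ha | ha
    · refine (h a ha π π').trans ?_
      gcongr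
      exact le_max_left C D
    · refine (h' a ha π π').trans ?_
      gcongr
      exact le_max_right C D
  · intro x _
    have hx : x ∈ closure (StarAlgebra.adjoin ℂ K : Set A) := by
      rw [← StarSubalgebra.topologicalClosure_coe, hgen]
      trivial
    obtain ⟨y, hy, hxy⟩ := Metric.mem_closure_iff.1 hx (ε / 2) (by positivity)
    obtain ⟨C, hC, h⟩ := exists_lipschitz_of_mem_adjoin hK hy
    refine ⟨Metric.ball y (ε / 2), mem_nhdsWithin_of_mem_nhds
      (Metric.isOpen_ball.mem_nhds hxy), C, hC, fun a ha π π' => ?_⟩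
    rw [Metric.mem_ball, dist_eq_norm] at ha
    have heq : π a - π' a = (π (a - y) - π' (a - y)) + (π y - π' y) := by
      rw [map_sub, map_sub]; abel
    rw [heq]
    refine norm_add_le_of_le ((RepSp.norm_sub_le π π' _).trans ?_) (h π π')
    linarith

lemma exists_isModulus_fMod_le {K L : Set A} (hK : IsCompact K) (hgen : Generates K)
    (hL : IsCompact L) :
    ∃ ω : ℝ → ℝ, IsModulus ω ∧ ∀ s ∈ Set.Ici (0 : ℝ), fMod K L s ≤ ω s := by
  have hbound : ∀ ε : ℝ, ∃ C : ℝ, 0 ≤ C ∧ (0 < ε → ∀ a ∈ L, ∀ π π' : RepSp A,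
      ‖π a - π' a‖ ≤ ε + C * dRep K π π') := by
    intro ε
    by_cases hε : 0 < ε
    · obtain ⟨C, hC, h⟩ := exists_affine_bound hK hgen hL hε
      exact ⟨C, hC, fun _ => h⟩
    · exact ⟨0, le_rfl, fun h => absurd h hε⟩
  choose c hc hcb using hbound
  obtain ⟨ω, hω, hdom⟩ := exists_isModulus_of_affine_bounds c hc
  refine ⟨ω, hω, fun s hs => Real.sSup_le ?_ (hω.2.2.2.2 s hs)⟩
  rintro _ ⟨a, ha, π, π', hd, rfl⟩
  refine hdom s hs _ fun ε hε => (hcb ε hε a ha π π').trans ?_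
  have := mul_le_mul_of_nonneg_left hd (hc ε)
  linarith

lemma norm_sub_le_fMod {K L : Set A} (hL : IsCompact L) {π π' : RepSp A} {t : ℝ}
    (hd : dRep K π π' ≤ t) {a : A} (ha : a ∈ L) : ‖π a - π' a‖ ≤ fMod K L t := by
  obtain ⟨M, hM⟩ := hL.isBounded.exists_norm_le
  refine le_csSup ⟨2 * M, ?_⟩ ⟨a, ha, π, π', hd, rfl⟩
  rintro _ ⟨b, hb, π, π', -, rfl⟩
  linarith [RepSp.norm_sub_le π π' b, hM b hb]

lemma fMod_nonneg (K L : Set A) (t : ℝ) : 0 ≤ fMod K L t :=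
  Real.sSup_nonneg (by rintro _ ⟨_, _, _, _, _, rfl⟩; exact norm_nonneg _)

lemma fMod_le_of_fMod_le (K' : Set A) {K L : Set A} (hK : IsCompact K) (hL : IsCompact L)
    {r s : ℝ} (hr : fMod K' K s ≤ r) : fMod K' L s ≤ fMod K L r := by
  refine Real.sSup_le ?_ (fMod_nonneg K L r)
  rintro _ ⟨a, ha, π, π', hd, rfl⟩
  exact norm_sub_le_fMod hL (dRep_le ((fMod_nonneg K' K s).trans hr) fun b hb =>
    (norm_sub_le_fMod hK hd hb).trans hr) ha

lemma omegaMod_le {K L : Set A} {ω : ℝ → ℝ} (hω : IsModulus ω)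
    (hdom : ∀ s ∈ Set.Ici (0 : ℝ), fMod K L s ≤ ω s) {t : ℝ} (ht : 0 ≤ t) :
    omegaMod K L t ≤ ω t :=
  csInf_le ⟨0, by rintro _ ⟨ω, hω, _, rfl⟩; exact hω.2.2.2.2 t ht⟩ ⟨ω, hω, hdom, rfl⟩

end Representations

open Filter Topology in
theorem stmt7 (A : Type*) [CStarAlgebra A] [TopologicalSpace.SeparableSpace A]
    (K K' : Set A) (hK : IsCompact K) (hgenK : Generates K)
    (hK' : IsCompact K') (hgenK' : Generates K') (a : A) :
    ∀ t : ℝ, 0 ≤ t →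
      omegaMod K' {a} t ≤ omegaMod K {a} (omegaMod K' K t) := by
  intro t ht
  obtain ⟨ω₀, hω₀, hdom₀⟩ := exists_isModulus_fMod_le hK hgenK (isCompact_singleton (x := a))
  refine le_csInf ⟨_, ω₀, hω₀, hdom₀, rfl⟩ ?_
  rintro _ ⟨ω, hω, hdom, rfl⟩
  obtain ⟨ω₁, hω₁, hdom₁⟩ := exists_isModulus_fMod_le hK' hgenK' hK
  let S : Set ℝ := {y : ℝ | ∃ ω : ℝ → ℝ, IsModulus ω ∧
    (∀ s ∈ Set.Ici (0 : ℝ), fMod K' K s ≤ ω s) ∧ y = ω t}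
  have hne : S.Nonempty := ⟨ω₁ t, ω₁, hω₁, hdom₁, rfl⟩
  have hbdd : BddBelow S :=
    ⟨0, by rintro _ ⟨ω, hω, _, rfl⟩; exact hω.2.2.2.2 t ht⟩
  obtain ⟨u, -, hu, hmem⟩ := exists_seq_tendsto_sInf hne hbdd
  have hu0 : ∀ n, u n ∈ Set.Ici (0 : ℝ) := by
    intro n
    obtain ⟨ω', hω', -, h⟩ := hmem n
    rw [h]
    exact hω'.2.2.2.2 t ht
  have hlim0 : omegaMod K' K t ∈ Set.Ici (0 : ℝ) := ge_of_tendsto' hu hu0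
  have hlim : Tendsto (fun n => ω (u n)) atTop (𝓝 (ω (omegaMod K' K t))) :=
    (hω.1 _ hlim0).tendsto.comp
      (tendsto_nhdsWithin_iff.2 ⟨hu, Eventually.of_forall hu0⟩)
  refine ge_of_tendsto' hlim fun n => ?_
  obtain ⟨ω', hω', hdom', h⟩ := hmem n
  rw [h]
  refine omegaMod_le (hω.comp hω') (fun s hs => ?_) ht
  exact (fMod_le_of_fMod_le K' hK isCompact_singleton (hdom' s hs)).trans
    (hdom _ (hω'.2.2.2.2 s hs))
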